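/- Let ρ = (ρ_n)_{n≥1} be a state with liminf_n H(ρ_n)/n < 1. Then there exist δ > 0, a strictly increasing sequence of natural numbers (n_m)_{m≥1}, and Hermitian projections G^m on ℂ^{2^{n_m}} such that for every m: 2^{-n_m}·Tr(G^m) < 2^{-m} and Tr(ρ_{n_m}·G^m) > δ. (This is the analytic content of the theorem that a computable quantum Schnorr random state has entropy rate 1: a state of entropy rate below 1 fails a test consisting of projections of geometrically small normalized trace.) -/

import Mathlib

open Matrix Filter MeasureTheory
open scoped ComplexOrder

/-- Von Neumann entropy of a Hermitian matrix: the Shannon entropy (base 2) of its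
eigenvalue distribution, with the convention `0 * log₂ 0 = 0` (automatic since
`Real.logb 2 0 = 0`). -/
noncomputable def vnEntropy {ι : Type} [Fintype ι] [DecidableEq ι]
    {A : Matrix ι ι ℂ} (hA : A.IsHermitian) : ℝ :=
  -∑ i, hA.eigenvalues i * Real.logb 2 (hA.eigenvalues i)

/-- A state: a sequence `ρ n` of density matrices on `ℂ^(2^n)` (rows and columns indexed by
length-`n` bitstrings) satisfying the partial-trace coherence condition. -/
structure QState where
  M : (n : ℕ) → Matrix (Fin n → Bool) (Fin n → Bool) ℂ
  posSemidef : ∀ n, (M n).PosSemidef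
  trace_one : ∀ n, (M n).trace = 1
  coherent : ∀ n (σ σ' : Fin n → Bool),
    M n σ σ' = M (n + 1) (Fin.snoc σ false) (Fin.snoc σ' false)
             + M (n + 1) (Fin.snoc σ true) (Fin.snoc σ' true)

/-- The von Neumann entropy of the length-`n` initial segment of a state. -/
noncomputable def QState.entropy (ρ : QState) (n : ℕ) : ℝ :=
  vnEntropy (ρ.posSemidef n).1

/-- The projection onto the span of the eigenvectors indexed by `S`, together with its trace and
its trace against the matrix itself. -/
theorem Matrix.IsHermitian.exists_spectral_projection {ι : Type} [Fintype ι] [DecidableEq ι]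
    {A : Matrix ι ι ℂ} (hA : A.IsHermitian) (S : Finset ι) :
    ∃ G : Matrix ι ι ℂ, G.IsHermitian ∧ G * G = G ∧ G.trace.re = S.card ∧
      (A * G).trace.re = ∑ i ∈ S, hA.eigenvalues i := by
  let U : Matrix ι ι ℂ := ↑hA.eigenvectorUnitary
  have hUU : star U * U = 1 := Unitary.coe_star_mul_self hA.eigenvectorUnitary
  set D : Matrix ι ι ℂ := diagonal fun i => if i ∈ S then 1 else 0 with hD
  have hspec : A = U * diagonal (fun i => (hA.eigenvalues i : ℂ)) * star U := by
    have h := hA.spectral_theorem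
    rw [Unitary.conjStarAlgAut_apply] at h
    exact h
  have hDD : D * D = D := by
    rw [hD, diagonal_mul_diagonal]
    congr 1
    ext i
    split_ifs <;> simp
  refine ⟨U * D * star U, ?_, ?_, ?_, ?_⟩
  · refine isHermitian_mul_mul_conjTranspose U ?_
    rw [hD, IsHermitian, diagonal_conjTranspose]
    congr 1
    ext i
    simp only [Pi.star_apply]
    split_ifs <;> simp
  · calc U * D * star U * (U * D * star U) = U * D * (star U * U) * D * star U := by
          simp only [Matrix.mul_assoc]
      _ = U * (D * D) * star U := by rw [hUU, Matrix.mul_one, Matrix.mul_assoc U D D]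
      _ = U * D * star U := by rw [hDD]
  · rw [trace_mul_comm, ← Matrix.mul_assoc, hUU, Matrix.one_mul, hD, trace_diagonal]
    simp
  · have h : A * (U * D * star U) =
        U * (diagonal (fun i => (hA.eigenvalues i : ℂ)) * D) * star U := by
      conv_lhs => rw [hspec]
      calc _ = U * diagonal (fun i => (hA.eigenvalues i : ℂ)) * (star U * U) * D * star U := by
            simp only [Matrix.mul_assoc]
        _ = _ := by rw [hUU, Matrix.mul_one, Matrix.mul_assoc U]
    rw [h, trace_mul_comm, ← Matrix.mul_assoc, hUU, Matrix.one_mul, hD, diagonal_mul_diagonal,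
      trace_diagonal]
    simp [Finset.sum_ite_mem]

/-- Shannon entropy is at most the logarithm of the alphabet size. -/
theorem neg_sum_mul_logb_le {ι : Type} [Fintype ι] {p : ι → ℝ} (hp : ∀ i, 0 ≤ p i)
    (hsum : ∑ i, p i = 1) :
    -∑ i, p i * Real.logb 2 (p i) ≤ Real.logb 2 (Fintype.card ι) := by
  have hne : Nonempty ι := by
    by_contra h
    rw [not_nonempty_iff] at h
    simp at hsum
  have hN : (0 : ℝ) < Fintype.card ι := by exact_mod_cast Fintype.card_pos
  have hterm : ∀ i, -(p i * Real.log (p i)) ≤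
      p i * Real.log (Fintype.card ι) + ((Fintype.card ι : ℝ)⁻¹ - p i) := by
    intro i
    rcases (hp i).eq_or_lt with h | h
    · rw [← h]
      simp
    · have h1 := Real.log_le_sub_one_of_pos (inv_pos.2 (mul_pos h hN))
      rw [Real.log_inv, Real.log_mul h.ne' hN.ne'] at h1
      have h2 := mul_le_mul_of_nonneg_left h1 h.le
      have h3 : p i * ((p i * (Fintype.card ι : ℝ))⁻¹ - 1) = (Fintype.card ι : ℝ)⁻¹ - p i := by
        field_simp
      rw [h3] at h2
      linarith
  have hle := Finset.sum_le_sum fun i (_ : i ∈ Finset.univ) => hterm i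
  rw [Finset.sum_add_distrib, Finset.sum_sub_distrib, ← Finset.sum_mul, hsum,
    Finset.sum_neg_distrib, Finset.sum_const, Finset.card_univ, nsmul_eq_mul,
    mul_inv_cancel₀ hN.ne'] at hle
  simp only [Real.logb, ← mul_div_assoc, ← Finset.sum_div, ← neg_div]
  gcongr
  linarith

/-- The set of outcomes of probability larger than `2 ^ (-t)` has at most `2 ^ t` elements, and
the probability of its complement is at most the entropy divided by `t`. -/
theorem exists_likely_finset {ι : Type} [Fintype ι] {p : ι → ℝ}
    (hp : ∀ i, 0 ≤ p i) (hsum : ∑ i, p i = 1) {t : ℝ} (ht : 0 < t) :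
    ∃ S : Finset ι, (S.card : ℝ) ≤ 2 ^ t ∧
      1 - (-∑ i, p i * Real.logb 2 (p i)) / t ≤ ∑ i ∈ S, p i := by
  classical
  have hpow : (0 : ℝ) < 2 ^ (-t) := by positivity
  have hp1 : ∀ i, p i ≤ 1 := fun i =>
    hsum ▸ Finset.single_le_sum (fun j _ => hp j) (Finset.mem_univ i)
  have hnonneg : ∀ i, 0 ≤ -(p i * Real.logb 2 (p i)) := fun i =>
    neg_nonneg.2 (mul_nonpos_of_nonneg_of_nonpos (hp i)
      (Real.logb_nonpos one_lt_two (hp i) (hp1 i)))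
  refine ⟨Finset.univ.filter fun i => 2 ^ (-t) < p i, ?_, ?_⟩
  · have h : ((Finset.univ.filter fun i => 2 ^ (-t) < p i).card : ℝ) * 2 ^ (-t) ≤ 1 := by
      rw [← hsum, ← nsmul_eq_mul]
      exact (Finset.card_nsmul_le_sum _ _ _ fun i hi => (Finset.mem_filter.1 hi).2.le).trans
        (Finset.sum_le_sum_of_subset_of_nonneg (Finset.filter_subset _ _) fun i _ _ => hp i)
    rwa [← le_div_iff₀ hpow, one_div, ← Real.rpow_neg zero_le_two, neg_neg] at h
  · have hsplit := Finset.sum_filter_add_sum_filter_not Finset.univ (fun i => 2 ^ (-t) < p i) p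
    have htail : (∑ i with ¬ 2 ^ (-t) < p i, p i) * t ≤ -∑ i, p i * Real.logb 2 (p i) := by
      rw [Finset.sum_mul, ← Finset.sum_neg_distrib]
      refine (Finset.sum_le_sum fun i hi => ?_).trans (Finset.sum_le_sum_of_subset_of_nonneg
        (Finset.filter_subset _ _) fun i _ _ => hnonneg i)
      rcases (hp i).eq_or_lt with h | h
      · simp [← h]
      · have hlog : Real.logb 2 (p i) ≤ -t :=
          (Real.logb_le_iff_le_rpow one_lt_two h).2 (not_lt.1 (Finset.mem_filter.1 hi).2)
        rw [← mul_neg]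
        exact mul_le_mul_of_nonneg_left (by linarith) h.le
    rw [← le_div_iff₀ ht] at htail
    linarith

theorem QState.eigenvalues_nonneg (ρ : QState) (n : ℕ) (i : Fin n → Bool) :
    0 ≤ (ρ.posSemidef n).1.eigenvalues i :=
  (ρ.posSemidef n).eigenvalues_nonneg i

theorem QState.sum_eigenvalues (ρ : QState) (n : ℕ) :
    ∑ i, (ρ.posSemidef n).1.eigenvalues i = 1 := by
  have h := (ρ.posSemidef n).1.trace_eq_sum_eigenvalues
  rw [ρ.trace_one] at h
  apply Complex.ofReal_injective
  rw [Complex.ofReal_sum, Complex.ofReal_one]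
  exact h.symm

theorem QState.entropy_div_le_one (ρ : QState) (n : ℕ) : ρ.entropy n / n ≤ 1 := by
  refine div_le_one_of_le₀ ?_ n.cast_nonneg
  refine (neg_sum_mul_logb_le (ρ.eigenvalues_nonneg n) (ρ.sum_eigenvalues n)).trans_eq ?_
  simp [Real.logb_pow]

/-- A state whose entropy rate `liminf_n H(ρ_n)/n` is below 1 fails a
test consisting of Hermitian projections of geometrically small normalized trace:
there are `δ > 0`, a strictly increasing sequence `n_m`, and Hermitian projections
`G^m` on `ℂ^(2^(n_m))` with `2^(-n_m)·Tr(G^m) < 2^(-m)` and `Tr(ρ_(n_m)·G^m) > δ`. -/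
theorem low_entropy_rate_fails_schnorr_type_test (ρ : QState)
    (hH : Filter.liminf (fun n : ℕ => ρ.entropy n / n) Filter.atTop < 1) :
    ∃ δ > (0 : ℝ), ∃ nm : ℕ → ℕ, StrictMono nm ∧
      ∃ G : (m : ℕ) → Matrix (Fin (nm m) → Bool) (Fin (nm m) → Bool) ℂ,
        ∀ m, (G m).IsHermitian ∧ G m * G m = G m ∧
          (2 : ℝ) ^ (-(nm m : ℤ)) * ((G m).trace).re < (2 : ℝ) ^ (-(m : ℤ)) ∧
          δ < ((ρ.M (nm m) * G m).trace).re := by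
  obtain ⟨c, hc, hc1⟩ := exists_between (max_lt hH one_pos)
  obtain ⟨hHc, hc0⟩ := max_lt_iff.1 hc
  obtain ⟨d, hcd, hd1⟩ := exists_between hc1
  have hd0 : 0 < d := hc0.trans hcd
  have hfreq : ∃ᶠ n : ℕ in atTop, ρ.entropy n / n < c :=
    frequently_lt_of_liminf_lt
      (IsBoundedUnder.isCoboundedUnder_ge (isBoundedUnder_of ⟨1, ρ.entropy_div_le_one⟩)) hHc
  have hlarge (m : ℕ) : ∃ᶠ n : ℕ in atTop,
      (ρ.entropy n / n < c ∧ 0 < n) ∧ (m : ℝ) / (1 - d) < n :=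
    (hfreq.and_eventually (eventually_gt_atTop 0)).and_eventually
      (tendsto_natCast_atTop_atTop.eventually_gt_atTop _)
  obtain ⟨nm, hmono, hnm⟩ := extraction_forall_of_frequently hlarge
  have hproj (m : ℕ) : ∃ G : Matrix (Fin (nm m) → Bool) (Fin (nm m) → Bool) ℂ,
      G.IsHermitian ∧ G * G = G ∧
        (2 : ℝ) ^ (-(nm m : ℤ)) * (G.trace).re < (2 : ℝ) ^ (-(m : ℤ)) ∧
        1 - c / d < ((ρ.M (nm m) * G).trace).re := by
    obtain ⟨⟨hent, hpos⟩, hm⟩ := hnm m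
    have hn : (0 : ℝ) < nm m := by exact_mod_cast hpos
    obtain ⟨S, hcard, hmass⟩ := exists_likely_finset (ρ.eigenvalues_nonneg (nm m))
      (ρ.sum_eigenvalues (nm m)) (mul_pos hd0 hn)
    obtain ⟨G, hG, hGG, htr, htrA⟩ :=
      (ρ.posSemidef (nm m)).1.exists_spectral_projection S
    refine ⟨G, hG, hGG, ?_, ?_⟩
    · rw [htr, ← Real.rpow_intCast, ← Real.rpow_intCast]
      push_cast
      calc (2 : ℝ) ^ (-(nm m : ℝ)) * S.card ≤ 2 ^ (-(nm m : ℝ)) * 2 ^ (d * nm m) := by gcongr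
        _ = 2 ^ (-(nm m : ℝ) + d * nm m) := (Real.rpow_add two_pos _ _).symm
        _ < 2 ^ (-(m : ℝ)) := by
          refine Real.rpow_lt_rpow_of_exponent_lt one_lt_two ?_
          rw [div_lt_iff₀ (by linarith)] at hm
          linarith
    · rw [htrA]
      refine lt_of_lt_of_le ?_ hmass
      change 1 - c / d < 1 - ρ.entropy (nm m) / (d * nm m)
      rw [mul_comm d, ← div_div]
      gcongr
  choose G hG using hproj
  exact ⟨1 - c / d, sub_pos.2 ((div_lt_one hd0).2 hcd), nm, hmono, G, hG⟩
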